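/- Under the stated assumptions on b and ρ, for every p > 1 the L^p(μ)-norm does not increase along the flow: for every t ≥ 0, ∫_{ℝ^d} ρ(t,·)^p dμ ≤ ∫_{ℝ^d} ρ(0,·)^p dμ. -/

import Mathlib

open MeasureTheory Real RealInnerProductSpace

/-- The standard Gaussian measure on `ℝ^d`. -/
noncomputable def stdGauss (d : ℕ) : Measure (EuclideanSpace ℝ (Fin d)) :=
  volume.withDensity fun ξ =>
    ENNReal.ofReal ((2 * π) ^ (-(d : ℝ) / 2) * Real.exp (-‖ξ‖ ^ 2 / 2))

/-- The Laplacian of a function on `ℝ^d`, as the divergence (trace of the derivative)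
of its gradient. -/
noncomputable def lap (d : ℕ) (f : EuclideanSpace ℝ (Fin d) → ℝ)
    (ξ : EuclideanSpace ℝ (Fin d)) : ℝ :=
  LinearMap.trace ℝ (EuclideanSpace ℝ (Fin d))
    (fderiv ℝ (fun x => gradient f x) ξ :
      EuclideanSpace ℝ (Fin d) →ₗ[ℝ] EuclideanSpace ℝ (Fin d))

/-- The Gaussian density. -/
noncomputable def gw (d : ℕ) (ξ : EuclideanSpace ℝ (Fin d)) : ℝ :=
  (2 * π) ^ (-(d : ℝ) / 2) * Real.exp (-‖ξ‖ ^ 2 / 2)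

lemma gw_pos (d : ℕ) (ξ : EuclideanSpace ℝ (Fin d)) : 0 < gw d ξ := by
  unfold gw; positivity

lemma gw_contDiff (d : ℕ) : ContDiff ℝ 1 (gw d) := by
  unfold gw
  have : ContDiff ℝ 1 (fun ξ : EuclideanSpace ℝ (Fin d) => ‖ξ‖ ^ 2) := contDiff_norm_sq ℝ
  fun_prop

lemma gw_fderiv (d : ℕ) (ξ v : EuclideanSpace ℝ (Fin d)) :
    fderiv ℝ (gw d) ξ v = - ⟪ξ, v⟫ * gw d ξ := by
  have h1 : HasFDerivAt (fun ξ : EuclideanSpace ℝ (Fin d) => ‖ξ‖ ^ 2) _ ξ :=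
    (hasStrictFDerivAt_norm_sq ξ).hasFDerivAt
  have h2 := ((h1.neg.mul_const (2⁻¹ : ℝ)).exp).const_mul ((2 * π) ^ (-(d : ℝ) / 2))
  have h3 : HasFDerivAt (gw d) _ ξ := h2
  rw [h3.fderiv]
  simp [gw]
  ring_nf

lemma integral_stdGauss (d : ℕ) (f : EuclideanSpace ℝ (Fin d) → ℝ) :
    ∫ ξ, f ξ ∂(stdGauss d) = ∫ ξ, f ξ * gw d ξ := by
  unfold stdGauss
  rw [integral_withDensity_eq_integral_toReal_smul]
  · refine integral_congr_ae (Filter.Eventually.of_forall fun ξ => ?_)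
    have := (gw_pos d ξ).le
    unfold gw at this
    simp only [ENNReal.toReal_ofReal this, smul_eq_mul, gw]
    ring
  · exact ((gw_contDiff d).continuous.measurable).ennreal_ofReal
  · exact Filter.Eventually.of_forall fun ξ => ENNReal.ofReal_lt_top

lemma gw_integrable (d : ℕ) : Integrable (fun ξ => (1 + ‖ξ‖) * gw d ξ) := by
  have h0 : Integrable (fun ξ : EuclideanSpace ℝ (Fin d) => Real.exp (-(1/4) * ‖ξ‖ ^ 2)) := by
    have := (GaussianFourier.integrable_cexp_neg_mul_sq_norm_add
      (V := EuclideanSpace ℝ (Fin d)) (b := (1/4 : ℂ)) (by norm_num) 0 0).norm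
    refine this.congr (Filter.Eventually.of_forall fun ξ => ?_)
    simp only [Complex.norm_exp]
    congr 1
    simp [← Complex.ofReal_pow]
  refine (h0.const_mul (3 * (2 * π) ^ (-(d : ℝ) / 2))).mono' ?_ ?_
  · exact (by have := (gw_contDiff d).continuous; fun_prop : Continuous _).aestronglyMeasurable
  · refine Filter.Eventually.of_forall fun ξ => ?_
    have hp := gw_pos d ξ
    rw [Real.norm_of_nonneg (by positivity)]
    unfold gw
    have e : Real.exp (-‖ξ‖ ^ 2 / 2) =
        Real.exp (-(1/4) * ‖ξ‖ ^ 2) * Real.exp (-(1/4) * ‖ξ‖ ^ 2) := by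
      rw [← Real.exp_add]; ring_nf
    have h1 : (1 + ‖ξ‖) ≤ 3 * Real.exp ((1/4) * ‖ξ‖ ^ 2) := by
      have := Real.add_one_le_exp ((1/4) * ‖ξ‖ ^ 2)
      nlinarith [sq_nonneg (‖ξ‖ - 1)]
    have h2 : (1 + ‖ξ‖) * Real.exp (-(1/4) * ‖ξ‖ ^ 2) ≤ 3 := by
      calc _ ≤ 3 * Real.exp ((1/4) * ‖ξ‖ ^ 2) * Real.exp (-(1/4) * ‖ξ‖ ^ 2) := by gcongr
        _ = 3 := by rw [mul_assoc, ← Real.exp_add]; simp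
    rw [e]
    calc _ = ((1 + ‖ξ‖) * Real.exp (-(1/4) * ‖ξ‖ ^ 2)) *
          ((2 * π) ^ (-(d : ℝ) / 2) * Real.exp (-(1/4) * ‖ξ‖ ^ 2)) := by ring
      _ ≤ 3 * ((2 * π) ^ (-(d : ℝ) / 2) * Real.exp (-(1/4) * ‖ξ‖ ^ 2)) := by gcongr
      _ = _ := by ring

/-- Functions of at most linear growth are Gaussian-integrable. -/
lemma gw_integrable_of_bound (d : ℕ) (f : EuclideanSpace ℝ (Fin d) → ℝ) (hf : Continuous f)
    (C : ℝ) (hC : ∀ ξ, |f ξ| ≤ C * (1 + ‖ξ‖)) : Integrable (fun ξ => f ξ * gw d ξ) := by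
  refine ((gw_integrable d).const_mul C).mono' ?_ ?_
  · exact (hf.mul (gw_contDiff d).continuous).aestronglyMeasurable
  · refine Filter.Eventually.of_forall fun ξ => ?_
    have hp := gw_pos d ξ
    rw [norm_mul, Real.norm_of_nonneg hp.le, Real.norm_eq_abs, ← mul_assoc]
    exact mul_le_mul_of_nonneg_right (hC ξ) hp.le

/-- Divergence. -/
noncomputable def dvg (d : ℕ) (V : EuclideanSpace ℝ (Fin d) → EuclideanSpace ℝ (Fin d))
    (ξ : EuclideanSpace ℝ (Fin d)) : ℝ :=
  LinearMap.trace ℝ (EuclideanSpace ℝ (Fin d))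
      (fderiv ℝ V ξ : EuclideanSpace ℝ (Fin d) →ₗ[ℝ] EuclideanSpace ℝ (Fin d))

lemma dvg_eq (d : ℕ) (V : EuclideanSpace ℝ (Fin d) → EuclideanSpace ℝ (Fin d))
    (ξ : EuclideanSpace ℝ (Fin d)) : dvg d V ξ =
    ∑ i, ⟪EuclideanSpace.basisFun (Fin d) ℝ i,
      fderiv ℝ V ξ (EuclideanSpace.basisFun (Fin d) ℝ i)⟫ := by
  unfold dvg
  rw [LinearMap.trace_eq_sum_inner _ (EuclideanSpace.basisFun (Fin d) ℝ)]
  rfl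

lemma dvg_bound (d : ℕ) (V : EuclideanSpace ℝ (Fin d) → EuclideanSpace ℝ (Fin d))
    (ξ : EuclideanSpace ℝ (Fin d)) : |dvg d V ξ| ≤ d * ‖fderiv ℝ V ξ‖ := by
  rw [dvg_eq]
  refine (Finset.abs_sum_le_sum_abs _ _).trans ?_
  refine (Finset.sum_le_sum (g := fun _ => ‖fderiv ℝ V ξ‖) fun i _ => ?_).trans (by simp)
  refine (abs_real_inner_le_norm _ _).trans ?_
  have := (fderiv ℝ V ξ).le_opNorm (EuclideanSpace.basisFun (Fin d) ℝ i)
  simpa using this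

lemma dvg_continuous (d : ℕ) (V : EuclideanSpace ℝ (Fin d) → EuclideanSpace ℝ (Fin d))
    (hV : ContDiff ℝ 1 V) : Continuous (dvg d V) := by
  have h := hV.continuous_fderiv one_ne_zero
  have : dvg d V = fun ξ => ∑ i, ⟪EuclideanSpace.basisFun (Fin d) ℝ i,
      fderiv ℝ V ξ (EuclideanSpace.basisFun (Fin d) ℝ i)⟫ := funext (dvg_eq d V)
  rw [this]
  fun_prop

/-- Gaussian divergence theorem. -/
lemma gauss_div (d : ℕ) (V : EuclideanSpace ℝ (Fin d) → EuclideanSpace ℝ (Fin d))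
    (hV : ContDiff ℝ 1 V) (A B : ℝ) (hA : ∀ ξ, ‖V ξ‖ ≤ A) (hB : ∀ ξ, ‖fderiv ℝ V ξ‖ ≤ B) :
    Integrable (fun ξ => (dvg d V ξ - ⟪V ξ, ξ⟫) * gw d ξ) ∧
    ∫ ξ, (dvg d V ξ - ⟪V ξ, ξ⟫) * gw d ξ = 0 := by
  have hA0 : 0 ≤ A := (norm_nonneg _).trans (hA 0)
  have hB0 : 0 ≤ B := (norm_nonneg _).trans (hB 0)
  have hd := hV.continuous_fderiv one_ne_zero
  have hc := hV.continuous
  set e := EuclideanSpace.basisFun (Fin d) ℝ with he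
  have hne : ∀ i, ‖e i‖ = 1 := fun i => by simp [he]
  have i1 : ∀ i, Integrable (fun ξ => ⟪e i, fderiv ℝ V ξ (e i)⟫ * gw d ξ) := fun i => by
    refine gw_integrable_of_bound d _ (by fun_prop) B fun ξ => ?_
    refine (abs_real_inner_le_norm _ _).trans ?_
    have := (fderiv ℝ V ξ).le_opNorm (e i)
    rw [hne] at *
    nlinarith [hB ξ, norm_nonneg ξ]
  have i2 : ∀ i, Integrable (fun ξ => (⟪e i, V ξ⟫ * ⟪ξ, e i⟫) * gw d ξ) := fun i => by
    refine gw_integrable_of_bound d _ (by fun_prop) A fun ξ => ?_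
    rw [abs_mul]
    have h1 := abs_real_inner_le_norm (e i) (V ξ)
    have h2 := abs_real_inner_le_norm ξ (e i)
    rw [hne] at *
    have := hA ξ
    calc _ ≤ A * ‖ξ‖ := by gcongr <;> linarith
      _ ≤ _ := by nlinarith
  have i3 : ∀ i, Integrable (fun ξ => ⟪e i, V ξ⟫ * gw d ξ) := fun i => by
    refine gw_integrable_of_bound d _ (by fun_prop) A fun ξ => ?_
    have h1 := abs_real_inner_le_norm (e i) (V ξ)
    rw [hne] at *
    have := hA ξ
    nlinarith [norm_nonneg ξ]
  have hfd : ∀ i ξ, fderiv ℝ (fun ξ => ⟪e i, V ξ⟫) ξ (e i) = ⟪e i, fderiv ℝ V ξ (e i)⟫ :=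
    fun i ξ => by
    have hh := (hV.differentiable one_ne_zero ξ).hasFDerivAt
    have := ((hasFDerivAt_const (e i) ξ).inner ℝ hh).fderiv
    rw [this]
    simp
  have key : ∀ i, ∫ ξ, (⟪e i, fderiv ℝ V ξ (e i)⟫ * gw d ξ - (⟪e i, V ξ⟫ * ⟪ξ, e i⟫) * gw d ξ)
      = 0 := fun i => by
    have hh : ∀ ξ, ⟪e i, V ξ⟫ * fderiv ℝ (gw d) ξ (e i) = - ((⟪e i, V ξ⟫ * ⟪ξ, e i⟫) * gw d ξ) :=
      fun ξ => by rw [gw_fderiv]; ring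
    have := integral_mul_fderiv_eq_neg_fderiv_mul_of_integrable (μ := volume)
      (f := fun ξ => ⟪e i, V ξ⟫) (g := gw d) (v := e i)
      (by simpa only [hfd] using i1 i)
      (by simp only [hh]; exact (i2 i).neg) (i3 i)
      (fun x _ => by
        exact (differentiableAt_const _).inner ℝ (hV.differentiable one_ne_zero x)) (fun x _ => (gw_contDiff d).differentiable one_ne_zero x)
    simp only [hfd, hh] at this
    rw [integral_neg] at this
    rw [integral_sub (i1 i) (i2 i)]
    linarith
  have hs : ∀ ξ, (dvg d V ξ - ⟪V ξ, ξ⟫) * gw d ξ =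
      ∑ i, (⟪e i, fderiv ℝ V ξ (e i)⟫ * gw d ξ - (⟪e i, V ξ⟫ * ⟪ξ, e i⟫) * gw d ξ) := fun ξ => by
    rw [Finset.sum_sub_distrib, ← Finset.sum_mul, ← Finset.sum_mul, ← dvg_eq, ← sub_mul]
    congr 2
    rw [real_inner_comm, ← OrthonormalBasis.sum_inner_mul_inner e]
    exact Finset.sum_congr rfl fun i _ => mul_comm _ _
  simp only [hs]
  refine ⟨integrable_finsetSum _ fun i _ => (i1 i).sub (i2 i), ?_⟩
  refine (integral_finsetSum _ fun i _ => (i1 i).sub (i2 i)).trans ?_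
  exact Finset.sum_eq_zero fun i _ => key i

lemma smul_field (d : ℕ) (u : EuclideanSpace ℝ (Fin d) → ℝ)
    (V : EuclideanSpace ℝ (Fin d) → EuclideanSpace ℝ (Fin d)) (ξ : EuclideanSpace ℝ (Fin d))
    (u' : EuclideanSpace ℝ (Fin d) →L[ℝ] ℝ) (hu : HasFDerivAt u u' ξ)
    (hV : DifferentiableAt ℝ V ξ) :
    ‖fderiv ℝ (fun x => u x • V x) ξ‖ ≤ |u ξ| * ‖fderiv ℝ V ξ‖ + ‖u'‖ * ‖V ξ‖ ∧
    dvg d (fun x => u x • V x) ξ = u ξ * dvg d V ξ + u' (V ξ) := by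
  have h : fderiv ℝ (fun x => u x • V x) ξ = _ := (hu.smul hV.hasFDerivAt).fderiv
  unfold dvg
  rw [h]
  constructor
  · refine (norm_add_le _ _).trans ?_
    rw [norm_smul, ContinuousLinearMap.norm_smulRight_apply, Real.norm_eq_abs]
  · have := LinearMap.trace_smulRight (u' : EuclideanSpace ℝ (Fin d) →ₗ[ℝ] ℝ) (V ξ)
    simp only [ContinuousLinearMap.toLinearMap_add, ContinuousLinearMap.toLinearMap_smul, map_add, map_smul, smul_eq_mul]
    congr 1

lemma gradient_facts (d : ℕ) (f : EuclideanSpace ℝ (Fin d) → ℝ) (hf : ContDiff ℝ 2 f) :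
    ContDiff ℝ 1 (gradient f) ∧ (∀ ξ, ‖gradient f ξ‖ = ‖iteratedFDeriv ℝ 1 f ξ‖) ∧
    (∀ ξ, ‖fderiv ℝ (gradient f) ξ‖ = ‖iteratedFDeriv ℝ 2 f ξ‖) := by
  have h1 : ContDiff ℝ 1 (fderiv ℝ f) := hf.fderiv_right (by norm_num)
  have hg : gradient f =
    (InnerProductSpace.toDual ℝ (EuclideanSpace ℝ (Fin d))).symm ∘ fderiv ℝ f := rfl
  refine ⟨?_, fun ξ => ?_, fun ξ => ?_⟩
  · rw [hg]
    exact (InnerProductSpace.toDual ℝ (EuclideanSpace ℝ (Fin d))).symm.toContinuousLinearEquiv.contDiff.comp h1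
  · rw [norm_iteratedFDeriv_one, hg]; simp
  · rw [← norm_iteratedFDeriv_fderiv, norm_iteratedFDeriv_one, hg]
    have := (InnerProductSpace.toDual ℝ (EuclideanSpace ℝ (Fin d))).symm.toContinuousLinearEquiv.comp_fderiv (f := fderiv ℝ f) (x := ξ)
    erw [this]
    exact LinearIsometry.norm_toContinuousLinearMap_comp (InnerProductSpace.toDual ℝ (EuclideanSpace ℝ (Fin d))).symm.toLinearIsometry

lemma rhs_bound (d : ℕ) (p α : ℝ) (hp : 1 < p) (hα : 0 ≤ α)
    (b : EuclideanSpace ℝ (Fin d) → EuclideanSpace ℝ (Fin d))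
    (f : EuclideanSpace ℝ (Fin d) → ℝ) (hf : ContDiff ℝ 2 f) (B C K : ℝ)
    (hB : ∀ ξ, ‖b ξ‖ ≤ B)
    (hf0 : ∀ ξ, 0 < f ξ) (hfC : ∀ ξ, f ξ ≤ C)
    (hK1 : ∀ ξ, ‖iteratedFDeriv ℝ 1 f ξ‖ ≤ K) (hK2 : ∀ ξ, ‖iteratedFDeriv ℝ 2 f ξ‖ ≤ K)
    (ξ : EuclideanSpace ℝ (Fin d)) :
    |p * f ξ ^ (p - 1) * (⟪b ξ, gradient f ξ⟫ + α * (lap d f ξ - ⟪ξ, gradient f ξ⟫))| ≤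
      (p * C ^ (p - 1) * (B * K + α * (d * K + K))) * (1 + ‖ξ‖) := by
  obtain ⟨_, hg1, hg2⟩ := gradient_facts d f hf
  have hK0 : 0 ≤ K := (norm_nonneg _).trans (hK1 0)
  have hB0 : 0 ≤ B := (norm_nonneg _).trans (hB 0)
  have h1 : |⟪b ξ, gradient f ξ⟫| ≤ B * K := by
    refine (abs_real_inner_le_norm _ _).trans ?_
    rw [hg1]
    exact mul_le_mul (hB ξ) (hK1 ξ) (norm_nonneg _) hB0
  have h2 : |⟪ξ, gradient f ξ⟫| ≤ ‖ξ‖ * K := by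
    refine (abs_real_inner_le_norm _ _).trans ?_
    rw [hg1]
    exact mul_le_mul_of_nonneg_left (hK1 ξ) (norm_nonneg _)
  have h3 : |lap d f ξ| ≤ d * K := by
    refine (dvg_bound d (gradient f) ξ).trans ?_
    rw [hg2]
    exact mul_le_mul_of_nonneg_left (hK2 ξ) (Nat.cast_nonneg _)
  have h4 : f ξ ^ (p - 1) ≤ C ^ (p - 1) :=
    Real.rpow_le_rpow (hf0 ξ).le (hfC ξ) (by linarith)
  have h5 : 0 ≤ f ξ ^ (p - 1) := Real.rpow_nonneg (hf0 ξ).le _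
  have h6 : |⟪b ξ, gradient f ξ⟫ + α * (lap d f ξ - ⟪ξ, gradient f ξ⟫)| ≤
      (B * K + α * (d * K + K)) * (1 + ‖ξ‖) := by
    calc _ ≤ |⟪b ξ, gradient f ξ⟫| + α * (|lap d f ξ| + |⟪ξ, gradient f ξ⟫|) := by
          refine (abs_add_le _ _).trans ?_
          rw [abs_mul, abs_of_nonneg hα]
          gcongr
          exact abs_sub _ _
      _ ≤ B * K + α * (d * K + ‖ξ‖ * K) := by gcongr
      _ ≤ _ := by
          have q1 : 0 ≤ B * K * ‖ξ‖ := by positivity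
          have q2 : 0 ≤ α * (d * K * ‖ξ‖) := by positivity
          have q3 : 0 ≤ α * K := by positivity
          nlinarith
  rw [abs_mul, abs_of_nonneg (by positivity), mul_assoc (p * C ^ (p - 1))]
  have h7 : 0 ≤ C ^ (p - 1) := h5.trans h4
  gcongr

lemma rhs_continuous (d : ℕ) (p α : ℝ)
    (b : EuclideanSpace ℝ (Fin d) → EuclideanSpace ℝ (Fin d)) (hb : Continuous b)
    (f : EuclideanSpace ℝ (Fin d) → ℝ) (hf : ContDiff ℝ 2 f) (hf0 : ∀ ξ, 0 < f ξ) :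
    Continuous fun ξ =>
      p * f ξ ^ (p - 1) * (⟪b ξ, gradient f ξ⟫ + α * (lap d f ξ - ⟪ξ, gradient f ξ⟫)) := by
  obtain ⟨hg0, _, _⟩ := gradient_facts d f hf
  have h1 : Continuous (lap d f) := dvg_continuous d (gradient f) hg0
  have h2 := hg0.continuous
  have h3 : Continuous fun ξ => f ξ ^ (p - 1) :=
    hf.continuous.rpow_const fun ξ => Or.inl (hf0 ξ).ne'
  fun_prop

lemma rhs_nonpos (d : ℕ) (p α : ℝ) (hp : 1 < p) (hα : 0 ≤ α)
    (b : EuclideanSpace ℝ (Fin d) → EuclideanSpace ℝ (Fin d))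
    (hbs : ContDiff ℝ 1 b) (hdiv : ∀ ξ, dvg d b ξ = 0) (horth : ∀ ξ, ⟪b ξ, ξ⟫ = 0)
    (f : EuclideanSpace ℝ (Fin d) → ℝ) (hf : ContDiff ℝ 2 f) (B B' C K ε : ℝ)
    (hB : ∀ ξ, ‖b ξ‖ ≤ B) (hB' : ∀ ξ, ‖fderiv ℝ b ξ‖ ≤ B')
    (hε : 0 < ε) (hfε : ∀ ξ, ε ≤ f ξ) (hfC : ∀ ξ, f ξ ≤ C)
    (hK1 : ∀ ξ, ‖iteratedFDeriv ℝ 1 f ξ‖ ≤ K) (hK2 : ∀ ξ, ‖iteratedFDeriv ℝ 2 f ξ‖ ≤ K) :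
    ∫ ξ, (p * f ξ ^ (p - 1) *
      (⟪b ξ, gradient f ξ⟫ + α * (lap d f ξ - ⟪ξ, gradient f ξ⟫))) * gw d ξ ≤ 0 := by
  obtain ⟨hg0, hg1, hg2⟩ := gradient_facts d f hf
  have hf0 : ∀ ξ, 0 < f ξ := fun ξ => hε.trans_le (hfε ξ)
  have hC0 : 0 < C := (hf0 0).trans_le (hfC 0)
  have hK0 : 0 ≤ K := (norm_nonneg _).trans (hK1 0)
  have hB0 : 0 ≤ B := (norm_nonneg _).trans (hB 0)
  have hB0' : 0 ≤ B' := (norm_nonneg _).trans (hB' 0)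
  have hd : ∀ ξ, HasFDerivAt f (fderiv ℝ f ξ) ξ :=
    fun ξ => (hf.differentiable two_ne_zero ξ).hasFDerivAt
  have hdK : ∀ ξ, ‖fderiv ℝ f ξ‖ ≤ K := fun ξ => by
    rw [← norm_iteratedFDeriv_one]; exact hK1 ξ
  have hrc : ∀ q : ℝ, ContDiff ℝ 1 (fun ξ => f ξ ^ q) := fun q =>
    ((hf.of_le (by norm_num)).rpow_const_of_ne fun ξ => (hf0 ξ).ne')
  have hrd : ∀ q ξ, HasFDerivAt (fun ξ => f ξ ^ q) ((q * f ξ ^ (q - 1)) • fderiv ℝ f ξ) ξ :=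
    fun q ξ => (hd ξ).rpow_const (Or.inl (hf0 ξ).ne')
  have hr : ∀ (q : ℝ) ξ, 0 ≤ q → f ξ ^ q ≤ C ^ q := fun q ξ hq =>
    Real.rpow_le_rpow (hf0 ξ).le (hfC ξ) hq
  have hrp : ∀ (q : ℝ) ξ, 0 < f ξ ^ q := fun q ξ => Real.rpow_pos_of_pos (hf0 ξ) _
  have hr2 : ∀ ξ, f ξ ^ (p - 1 - 1) ≤ C ^ (p - 1) / ε := fun ξ => by
    rw [Real.rpow_sub_one (hf0 ξ).ne']
    exact div_le_div₀ (by positivity) (hr _ ξ (by linarith)) hε (hfε ξ)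
  have hp0 : 0 < p := by linarith
  have hp1 : 0 < p - 1 := by linarith
  -- the two vector fields
  have F1 := fun ξ => smul_field d (fun ξ => f ξ ^ p) b ξ _ (hrd p ξ)
    (hbs.differentiable one_ne_zero ξ)
  have F2 := fun ξ => smul_field d (fun ξ => f ξ ^ (p - 1)) (gradient f) ξ _ (hrd (p - 1) ξ)
    (hg0.differentiable one_ne_zero ξ)
  have G1 := gauss_div d (fun ξ => f ξ ^ p • b ξ) ((hrc p).smul hbs) (C ^ p * B)
    (C ^ p * B' + p * C ^ (p - 1) * K * B)
    (fun ξ => by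
      rw [norm_smul, Real.norm_of_nonneg (hrp _ _).le]
      exact mul_le_mul (hr _ ξ hp0.le) (hB ξ) (norm_nonneg _) (by positivity))
    (fun ξ => by
      refine (F1 ξ).1.trans ?_
      have := hrp (p - 1) ξ
      rw [abs_of_pos (hrp _ _), norm_smul, Real.norm_of_nonneg (by positivity)]
      gcongr
      · exact (hf0 ξ).le
      · exact hfC ξ
      · exact hB' ξ
      · exact (hf0 ξ).le
      · exact hfC ξ
      · exact hdK ξ
      · exact hB ξ)
  have G2 := gauss_div d (fun ξ => f ξ ^ (p - 1) • gradient f ξ) ((hrc _).smul hg0)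
    (C ^ (p - 1) * K)
    (C ^ (p - 1) * K + (p - 1) * (C ^ (p - 1) / ε) * K * K)
    (fun ξ => by
      rw [norm_smul, Real.norm_of_nonneg (hrp _ _).le, hg1]
      exact mul_le_mul (hr _ ξ hp1.le) (hK1 ξ) (norm_nonneg _) (by positivity))
    (fun ξ => by
      refine (F2 ξ).1.trans ?_
      have := hrp (p - 1 - 1) ξ
      rw [abs_of_pos (hrp _ _), norm_smul, Real.norm_of_nonneg (by positivity), hg1, hg2]
      gcongr
      · exact (hf0 ξ).le
      · exact hfC ξ
      · exact hK2 ξ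
      · exact hr2 ξ
      · exact hdK ξ
      · exact hK1 ξ)
  have hI : Integrable (fun ξ => (p * f ξ ^ (p - 1) *
      (⟪b ξ, gradient f ξ⟫ + α * (lap d f ξ - ⟪ξ, gradient f ξ⟫))) * gw d ξ) :=
    gw_integrable_of_bound d _ (rhs_continuous d p α b hbs.continuous f hf hf0) _
      (rhs_bound d p α hp hα b f hf B C K hB hf0 hfC hK1 hK2)
  have hI2 := G1.1.add (G2.1.const_mul (α * p))
  calc _ ≤ ∫ ξ, ((dvg d (fun ξ => f ξ ^ p • b ξ) ξ - ⟪f ξ ^ p • b ξ, ξ⟫) * gw d ξ +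
        (α * p) * ((dvg d (fun ξ => f ξ ^ (p - 1) • gradient f ξ) ξ -
          ⟪f ξ ^ (p - 1) • gradient f ξ, ξ⟫) * gw d ξ)) := by
        refine integral_mono hI hI2 fun ξ => ?_
        have hw := gw_pos d ξ
        have e1 : dvg d (gradient f) ξ = lap d f ξ := rfl
        have e2 : fderiv ℝ f ξ (b ξ) = ⟪b ξ, gradient f ξ⟫ := by
          rw [real_inner_comm, inner_gradient_left]
        have e3 : fderiv ℝ f ξ (gradient f ξ) = ‖gradient f ξ‖ ^ 2 := by
          rw [← inner_gradient_left, real_inner_self_eq_norm_sq]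
        have e4 : ⟪gradient f ξ, ξ⟫ = ⟪ξ, gradient f ξ⟫ := real_inner_comm _ _
        simp only [(F1 ξ).2, (F2 ξ).2, hdiv, inner_smul_left, horth, e1, e4,
          smul_apply, e2, e3, smul_eq_mul, conj_trivial]
        have := hrp (p - 1 - 1) ξ
        have key : 0 ≤ α * p * ((p - 1) * f ξ ^ (p - 1 - 1) * ‖gradient f ξ‖ ^ 2) * gw d ξ := by
          positivity
        linarith
    _ = 0 := by
        rw [integral_add G1.1 (G2.1.const_mul (α * p)), integral_const_mul, G1.2, G2.2]
        simp

theorem stmt8 (d : ℕ) (p : ℝ) (hp : 1 < p) (α : ℝ) (hα : 0 ≤ α)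
    (b : EuclideanSpace ℝ (Fin d) → EuclideanSpace ℝ (Fin d))
    (hbsmooth : ContDiff ℝ (⊤ : ℕ∞) b) (hbsupp : HasCompactSupport b)
    (hdiv : ∀ ξ, LinearMap.trace ℝ (EuclideanSpace ℝ (Fin d))
      (fderiv ℝ b ξ : EuclideanSpace ℝ (Fin d) →ₗ[ℝ] EuclideanSpace ℝ (Fin d)) = 0)
    (horth : ∀ ξ, ⟪b ξ, ξ⟫ = 0)
    (ρ : ℝ → EuclideanSpace ℝ (Fin d) → ℝ)
    (hbd : ∃ C, ∀ t ≥ (0 : ℝ), ∀ ξ, |ρ t ξ| ≤ C)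
    (htreg : ∀ ξ, ContDiffOn ℝ 1 (fun t => ρ t ξ) (Set.Ici 0))
    (hxreg : ∀ t ≥ (0 : ℝ), ContDiff ℝ 2 (ρ t))
    (hxbd : ∃ C, ∀ t ≥ (0 : ℝ), ∀ ξ, ‖iteratedFDeriv ℝ 1 (ρ t) ξ‖ ≤ C ∧
      ‖iteratedFDeriv ℝ 2 (ρ t) ξ‖ ≤ C)
    (hinf : ∀ T > (0 : ℝ), ∃ ε > (0 : ℝ), ∀ t ∈ Set.Icc (0 : ℝ) T, ∀ ξ, ε ≤ ρ t ξ)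
    (hpde : ∀ t > (0 : ℝ), ∀ ξ, HasDerivAt (fun s => ρ s ξ)
      (⟪b ξ, gradient (ρ t) ξ⟫ + α * (lap d (ρ t) ξ - ⟪ξ, gradient (ρ t) ξ⟫)) t) :
    ∀ t ≥ (0 : ℝ),
      ∫ ξ, ρ t ξ ^ p ∂(stdGauss d) ≤ ∫ ξ, ρ 0 ξ ^ p ∂(stdGauss d) := by
  obtain ⟨C, hC⟩ := hbd
  obtain ⟨K, hK⟩ := hxbd
  have hb1 : ContDiff ℝ 1 b := hbsmooth.of_le (by exact_mod_cast le_top)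
  obtain ⟨B, hB⟩ := hbsupp.exists_bound_of_continuous hb1.continuous
  obtain ⟨B', hB'⟩ := (hbsupp.fderiv (𝕜 := ℝ)).exists_bound_of_continuous
    (hb1.continuous_fderiv one_ne_zero)
  have hpos : ∀ t ≥ (0 : ℝ), ∀ ξ, 0 < ρ t ξ := fun t ht ξ => by
    obtain ⟨ε, h0, h⟩ := hinf (t + 1) (by linarith)
    exact h0.trans_le (h t ⟨ht, by linarith⟩ ξ)
  have hle : ∀ t ≥ (0 : ℝ), ∀ ξ, ρ t ξ ≤ C := fun t ht ξ => (le_abs_self _).trans (hC t ht ξ)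
  have hp0 : 0 < p := by linarith
  have hcont : ∀ t ≥ (0 : ℝ), Continuous fun ξ => ρ t ξ ^ p := fun t ht =>
    (hxreg t ht).continuous.rpow_const fun ξ => Or.inl (hpos t ht ξ).ne'
  have hpb : ∀ t ≥ (0 : ℝ), ∀ ξ, |ρ t ξ ^ p| ≤ C ^ p * (1 + ‖ξ‖) := fun t ht ξ => by
    have h1 := Real.rpow_nonneg (hpos t ht ξ).le p
    have h2 := Real.rpow_le_rpow (hpos t ht ξ).le (hle t ht ξ) hp0.le
    rw [abs_of_nonneg h1]
    nlinarith [norm_nonneg ξ]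
  have hint : ∀ t ≥ (0 : ℝ), Integrable fun ξ => ρ t ξ ^ p * gw d ξ := fun t ht =>
    gw_integrable_of_bound d _ (hcont t ht) _ (hpb t ht)
  have hgc := (gw_contDiff d).continuous
  set F : ℝ → ℝ := fun t => ∫ ξ, ρ t ξ ^ p * gw d ξ with hF
  have hFc : ContinuousOn F (Set.Ici 0) := by
    refine continuousOn_of_dominated (bound := fun ξ => C ^ p * ((1 + ‖ξ‖) * gw d ξ)) ?_ ?_ ?_ ?_
    · exact fun t ht => (hint t ht).aestronglyMeasurable
    · refine fun t ht => Filter.Eventually.of_forall fun ξ => ?_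
      rw [norm_mul, Real.norm_of_nonneg (gw_pos d ξ).le, ← mul_assoc]
      exact mul_le_mul_of_nonneg_right (hpb t ht ξ) (gw_pos d ξ).le
    · exact (gw_integrable d).const_mul _
    · refine Filter.Eventually.of_forall fun ξ => ?_
      exact ((htreg ξ).continuousOn.rpow_const fun t ht => Or.inl (hpos t ht ξ).ne').mul
        continuousOn_const
  have hFd : ∀ t > (0 : ℝ), HasDerivAt F (∫ ξ, (p * ρ t ξ ^ (p - 1) *
      (⟪b ξ, gradient (ρ t) ξ⟫ + α * (lap d (ρ t) ξ - ⟪ξ, gradient (ρ t) ξ⟫))) * gw d ξ) t := by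
    intro t ht
    refine (hasDerivAt_integral_of_dominated_loc_of_deriv_le (s := Set.Ioi 0)
      (F' := fun t ξ => (p * ρ t ξ ^ (p - 1) *
      (⟪b ξ, gradient (ρ t) ξ⟫ + α * (lap d (ρ t) ξ - ⟪ξ, gradient (ρ t) ξ⟫))) * gw d ξ)
      (bound := fun ξ => (p * C ^ (p - 1) * (B * K + α * (d * K + K))) * ((1 + ‖ξ‖) * gw d ξ))
      (Ioi_mem_nhds ht) ?_ (hint t ht.le) ?_ ?_ ?_ ?_).2
    · filter_upwards [Ioi_mem_nhds ht] with s hs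
      exact (hint s (le_of_lt hs)).aestronglyMeasurable
    · exact ((rhs_continuous d p α b hb1.continuous (ρ t) (hxreg t ht.le)
        (hpos t ht.le)).mul hgc).aestronglyMeasurable
    · refine Filter.Eventually.of_forall fun ξ s hs => ?_
      have hs' : (0 : ℝ) ≤ s := le_of_lt hs
      rw [norm_mul, Real.norm_of_nonneg (gw_pos d ξ).le, ← mul_assoc]
      exact mul_le_mul_of_nonneg_right (rhs_bound d p α hp hα b (ρ s) (hxreg s hs') B C K hB
        (hpos s hs') (hle s hs') (fun ξ => (hK s hs' ξ).1) (fun ξ => (hK s hs' ξ).2) ξ)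
        (gw_pos d ξ).le
    · exact (gw_integrable d).const_mul _
    · refine Filter.Eventually.of_forall fun ξ s hs => ?_
      have h := ((hpde s hs ξ).rpow_const (p := p)
        (Or.inl (hpos s (le_of_lt hs) ξ).ne')).mul_const (gw d ξ)
      exact h.congr_deriv (by ring)
  have hanti : AntitoneOn F (Set.Ici 0) := by
    refine antitoneOn_of_deriv_nonpos (convex_Ici 0) hFc ?_ ?_
    · rw [interior_Ici]
      exact fun t ht => (hFd t ht).differentiableAt.differentiableWithinAt
    · rw [interior_Ici]
      intro t ht
      have ht' : (0 : ℝ) ≤ t := le_of_lt ht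
      rw [(hFd t ht).deriv]
      obtain ⟨ε, hε, h⟩ := hinf t ht
      exact rhs_nonpos d p α hp hα b hb1 hdiv horth (ρ t) (hxreg t ht') B B' C K ε hB hB' hε
        (h t ⟨ht', le_rfl⟩) (hle t ht') (fun ξ => (hK t ht' ξ).1) (fun ξ => (hK t ht' ξ).2)
  intro t ht
  rw [integral_stdGauss, integral_stdGauss]
  exact hanti Set.self_mem_Ici ht ht
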